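/- Let Y be a Banach space, S, Ŝ, T ∈ L(Y) with T compact, ρ₀ > 0, and suppose the spectral radius of Ŝ is strictly less than ρ₀. If for every λ on the circle of radius ρ₀ we have ‖(T - S)T‖ < ρ₀ · (‖(Ŝ - λI)⁻¹‖⁻¹ - ‖S - Ŝ‖), then the spectral radius of T is strictly less than ρ₀. -/

import Mathlib

/-- a criterion for the spectral radius of a compact operator `T` to be `< ρ₀`,
via an approximation `S` and a computable approximation `Ŝ` of `S`. -/
theorem stmt_3 {Y : Type*} [NormedAddCommGroup Y] [NormedSpace ℂ Y] [CompleteSpace Y]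
    (S Shat T : Y →L[ℂ] Y) (hT : IsCompactOperator ⇑T)
    (ρ₀ : ℝ) (hρ : 0 < ρ₀)
    (hShat : spectralRadius ℂ Shat < ENNReal.ofReal ρ₀)
    (hbound : ∀ l : ℂ, ‖l‖ = ρ₀ →
      ‖(T - S) ∘L T‖ < ρ₀ * (‖Ring.inverse (Shat - l • (1 : Y →L[ℂ] Y))‖⁻¹ - ‖S - Shat‖)) :
    spectralRadius ℂ T < ENNReal.ofReal ρ₀ := by
  rcases (spectrum ℂ T).eq_empty_or_nonempty with he | hne
  · simp [spectralRadius, he, hρ]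
  set r : NNReal := (ρ₀⁻¹).toNNReal with hr
  have hrρ : (r : ℝ) = ρ₀⁻¹ := Real.coe_toNNReal _ (by positivity)
  have hr_lt : (r : ENNReal) < (spectralRadius ℂ Shat)⁻¹ := by
    rw [ENNReal.lt_inv_iff_lt_inv]
    have : (r : ENNReal)⁻¹ = ENNReal.ofReal ρ₀ := by
      change (ENNReal.ofReal ρ₀⁻¹)⁻¹ = _
      rw [ENNReal.ofReal_inv_of_pos hρ, inv_inv]
    rwa [this]
  have hunit : ∀ z : ℂ, ‖z‖ ≤ ρ₀⁻¹ → IsUnit (1 - z • Shat) := by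
    intro z hz
    apply spectrum.isUnit_one_sub_smul_of_lt_inv_radius
    refine lt_of_le_of_lt ?_ hr_lt
    rw [← hrρ] at hz
    exact_mod_cast hz
  let f : ℂ → (Y →L[ℂ] Y) := fun z => z • Ring.inverse (1 - z • Shat)
  have hf : DifferentiableOn ℂ f (Metric.closedBall 0 ρ₀⁻¹) := by
    have h := spectrum.differentiableOn_inverse_one_sub_smul hr_lt
    rw [hrρ] at h
    exact differentiableOn_id.smul h
  have hρ' : 0 < ρ₀⁻¹ := inv_pos.mpr hρ
  have hcl : closure (Metric.ball (0 : ℂ) ρ₀⁻¹) = Metric.closedBall 0 ρ₀⁻¹ :=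
    closure_ball _ hρ'.ne'
  obtain ⟨z₀, hz₀, hmax⟩ := Complex.exists_mem_frontier_isMaxOn_norm (f := f)
    (U := Metric.ball (0 : ℂ) ρ₀⁻¹) Metric.isBounded_ball ⟨0, by simpa using hρ⟩
    (DifferentiableOn.diffContOnCl (by rw [hcl]; exact hf))
  rw [frontier_ball _ hρ'.ne', mem_sphere_zero_iff_norm] at hz₀
  rw [hcl] at hmax
  have hz₀0 : z₀ ≠ 0 := by
    rintro rfl
    rw [norm_zero] at hz₀
    exact hρ'.ne hz₀
  have hinv : Ring.inverse (Shat - z₀⁻¹ • (1 : Y →L[ℂ] Y)) = - f z₀ := by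
    have hu := hunit z₀ hz₀.le
    have e : (Shat - z₀⁻¹ • (1 : Y →L[ℂ] Y)) = (-z₀⁻¹) • (1 - z₀ • Shat) := by
      rw [smul_sub, smul_smul, neg_mul, inv_mul_cancel₀ hz₀0]
      module
    have h1 : (Shat - z₀⁻¹ • (1 : Y →L[ℂ] Y)) * (- f z₀) = 1 := by
      rw [e]
      simp only [f, mul_neg, smul_mul_assoc, mul_smul_comm, Ring.mul_inverse_cancel _ hu,
        smul_smul]
      rw [mul_inv_cancel₀ hz₀0]
      simp
    have hu' : IsUnit (Shat - z₀⁻¹ • (1 : Y →L[ℂ] Y)) := by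
      rw [e]
      exact hu.smul (Units.mk0 (-z₀⁻¹) (by simpa using hz₀0))
    calc Ring.inverse (Shat - z₀⁻¹ • (1 : Y →L[ℂ] Y))
        = Ring.inverse (Shat - z₀⁻¹ • (1 : Y →L[ℂ] Y)) *
            ((Shat - z₀⁻¹ • (1 : Y →L[ℂ] Y)) * (- f z₀)) := by rw [h1, mul_one]
      _ = - f z₀ := Ring.inverse_mul_cancel_left _ _ hu'
  have hb := hbound z₀⁻¹ (by rw [norm_inv, hz₀, inv_inv])
  rw [hinv, norm_neg] at hb
  apply spectrum.spectralRadius_lt_of_forall_lt_of_nonempty hne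
  intro k hk
  by_contra hlt
  have hkρ : ρ₀ ≤ ‖k‖ := by
    rw [not_lt] at hlt
    exact Real.toNNReal_le_iff_le_coe.mp hlt
  have hkpos : 0 < ‖k‖ := hρ.trans_le hkρ
  have hk0 : k ≠ 0 := norm_pos_iff.mp hkpos
  obtain ⟨y, hy⟩ := ((IsCompactOperator.hasEigenvalue_iff_mem_spectrum hT hk0).mpr
    hk).exists_hasEigenvector
  have hTy : T y = k • y := hy.apply_eq_smul
  have hypos : 0 < ‖y‖ := norm_pos_iff.mpr hy.2
  have hkinv : ‖k⁻¹‖ ≤ ρ₀⁻¹ := by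
    rw [norm_inv]; exact inv_anti₀ hρ hkρ
  have hfM : ‖f k⁻¹‖ ≤ ‖f z₀‖ := hmax (by simpa using hkinv)
  have hfy : f k⁻¹ (k • y - Shat y) = y := by
    have h1 := congrArg (fun A : Y →L[ℂ] Y => A y)
      (Ring.inverse_mul_cancel _ (hunit k⁻¹ hkinv))
    have h2 : k • y - Shat y = k • ((1 - k⁻¹ • Shat) y) := by
      simp [smul_sub, smul_smul, hk0]
    rw [h2]
    simp only [f, map_smul, smul_apply, smul_smul]
    rw [mul_inv_cancel₀ hk0, one_smul]
    exact h1
  have hdec : k • y - Shat y = k⁻¹ • (((T - S) ∘L T) y) + (S - Shat) y := by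
    simp [hTy, smul_sub, smul_smul, hk0]
  have hnorm : ‖k • y - Shat y‖ ≤ (ρ₀⁻¹ * ‖(T - S) ∘L T‖ + ‖S - Shat‖) * ‖y‖ := by
    rw [hdec]
    refine (norm_add_le _ _).trans ?_
    rw [norm_smul, add_mul, mul_assoc]
    gcongr
    · exact ContinuousLinearMap.le_opNorm _ _
    · exact ContinuousLinearMap.le_opNorm _ _
  set a := ‖(T - S) ∘L T‖ with ha
  set b := ‖S - Shat‖ with hbdef
  set M := ‖f z₀‖ with hM
  have hfin : ‖y‖ ≤ M * ((ρ₀⁻¹ * a + b) * ‖y‖) := by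
    calc ‖y‖ = ‖f k⁻¹ (k • y - Shat y)‖ := by rw [hfy]
      _ ≤ ‖f k⁻¹‖ * ‖k • y - Shat y‖ := ContinuousLinearMap.le_opNorm _ _
      _ ≤ M * ((ρ₀⁻¹ * a + b) * ‖y‖) := by gcongr
  have h1 : 1 ≤ M * (ρ₀⁻¹ * a + b) := by
    rw [← mul_assoc] at hfin
    exact (le_mul_iff_one_le_left hypos).mp hfin
  have hMpos : 0 < M := by
    rcases (norm_nonneg (f z₀)).eq_or_lt with h | h
    · rw [hM, ← h] at h1
      norm_num at h1
    · exact h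
  have h2 : ρ₀⁻¹ * a + b < M⁻¹ := by
    have : ρ₀⁻¹ * a < M⁻¹ - b := by
      rw [inv_mul_lt_iff₀ hρ]; exact hb
    linarith
  have h3 : M * (ρ₀⁻¹ * a + b) < M * M⁻¹ := mul_lt_mul_of_pos_left h2 hMpos
  rw [mul_inv_cancel₀ hMpos.ne'] at h3
  linarith
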